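/- arXiv:2107.02707 — 6 statements merged into one kernel-verified Lean document; each statement's English description precedes it below -/
import Mathlib

section
/- Let R be a principal ideal domain with field of fractions F and let A ∈ M_{m,n}(R) have rank r with 0 < r < n. Then A is associated to a reduced matrix; that is, there exist L ∈ GL_m(F), a permutation matrix Σ ∈ GL_n(R), a nonzero d ∈ R, and K ∈ M_{r,n−r}(R) such that L·A·Σ is the block matrix with blocks d·I_r and K in the first r rows and zero in the remaining m−r rows. -/
/-- Two injective families in finite types of the same cardinality are matched by a bijection. -/
theorem exists_equiv_apply_eq_of_injective {κ α β : Type*} [Fintype α] [Fintype β]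
    (hcard : Fintype.card α = Fintype.card β) {f : κ → α} {g : κ → β}
    (hf : Function.Injective f) (hg : Function.Injective g) :
    ∃ e : α ≃ β, ∀ k, e (f k) = g k := by
  classical
  let e₀ : α ≃ β := Fintype.equivOfCardEq hcard
  have hf₀ : Function.Injective (e₀ ∘ f) := e₀.injective.comp hf
  let E : {x // x ∈ Set.range (e₀ ∘ f)} ≃ {x // x ∈ Set.range g} :=
    (Equiv.ofInjective _ hf₀).symm.trans (Equiv.ofInjective _ hg)
  refine ⟨e₀.trans E.extendSubtype, fun k => ?_⟩
  have hE : E ⟨(e₀ ∘ f) k, k, rfl⟩ = ⟨g k, k, rfl⟩ := by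
    simp only [E, Equiv.trans_apply, Equiv.ofInjective_symm_apply]
    rfl
  exact (E.extendSubtype_apply_of_mem _ ⟨k, rfl⟩).trans (congrArg Subtype.val hE)

/-- A linearly independent family extends to a basis with a prescribed index type. -/
theorem LinearIndependent.exists_basis_extending {K V κ ι : Type*} [Field K] [AddCommGroup V]
    [Module K V] [FiniteDimensional K V] [Fintype ι] {v : κ → V} (hv : LinearIndependent K v)
    (hι : Module.finrank K V = Fintype.card ι) {f : κ → ι} (hf : Function.Injective f) :
    ∃ b : Module.Basis ι K V, ∀ k, b (f k) = v k := by
  let b₀ := Module.Basis.sumExtend hv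
  have := Module.Finite.finite_basis b₀
  have := Fintype.ofFinite (κ ⊕ Module.Basis.sumExtendIndex hv)
  obtain ⟨e, he⟩ := exists_equiv_apply_eq_of_injective
    ((Module.finrank_eq_card_basis b₀).symm.trans hι) Sum.inl_injective hf
  refine ⟨b₀.reindex e, fun k => ?_⟩
  rw [Module.Basis.reindex_apply, ← he k, e.symm_apply_apply]
  simp only [b₀, Module.Basis.sumExtend, Module.Basis.reindex_apply, Module.Basis.coe_extend]
  rfl

/-- Over a field, a matrix of rank `r` becomes `[[I_r, *], [0, 0]]` after multiplying by an
invertible matrix on the left and permuting the columns. -/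
theorem Matrix.exists_units_mul_apply_perm_of_rank_eq {K : Type*} [Field K] {m n r : ℕ}
    (B : Matrix (Fin m) (Fin n) K) (hB : B.rank = r) :
    ∃ (L : (Matrix (Fin m) (Fin m) K)ˣ) (τ : Equiv.Perm (Fin n)),
      (∀ (i : Fin m) (j : Fin n), (j : ℕ) < r → (L.val * B) i (τ j) = if (i : ℕ) = (j : ℕ) then 1 else 0) ∧
      ∀ (i : Fin m) (j : Fin n), r ≤ (i : ℕ) → (L.val * B) i j = 0 := by
  have hrm : r ≤ m := hB ▸ by simpa using B.rank_le_card_height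
  have hrn : r ≤ n := hB ▸ by simpa using B.rank_le_card_width
  obtain ⟨κ, a, ha, hspan, hli⟩ := exists_linearIndependent' K B.col
  have := Finite.of_injective a ha
  have := Fintype.ofFinite κ
  have hκ : Fintype.card κ = r := by
    rw [← finrank_span_eq_card hli, hspan, ← Matrix.rank_eq_finrank_span_cols, hB]
  let ε : κ ≃ Fin r := Fintype.equivFinOfCardEq hκ
  obtain ⟨τ, hτ⟩ := exists_equiv_apply_eq_of_injective rfl
    ((Fin.castLE_injective hrn).comp ε.injective) ha
  obtain ⟨b, hb⟩ := hli.exists_basis_extending (ι := Fin m) (by simp)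
    ((Fin.castLE_injective hrm).comp ε.injective)
  have hcol : (Pi.basisFun K (Fin m)).toMatrix B.col = B := by
    ext i j
    simp [Module.Basis.toMatrix_apply]
  have hmul : ∀ i j, (b.toMatrix (Pi.basisFun K (Fin m)) * B) i j = b.repr (B.col j) i := by
    intro i j
    conv_lhs => rw [← hcol, Module.Basis.toMatrix_mul_toMatrix]
    rfl
  refine ⟨⟨b.toMatrix (Pi.basisFun K (Fin m)), (Pi.basisFun K (Fin m)).toMatrix b,
    b.toMatrix_mul_toMatrix_flip _, Module.Basis.toMatrix_mul_toMatrix_flip _ _⟩, τ, ?_, ?_⟩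
  · intro i j hj
    have hk : Fin.castLE hrn (ε (ε.symm ⟨j, hj⟩)) = j := by ext; simp
    have hτj : τ j = a (ε.symm ⟨j, hj⟩) := by
      rw [← hτ, Function.comp_apply, hk]
    rw [hmul, hτj]
    have hbj : b _ = B.col (a (ε.symm ⟨j, hj⟩)) := hb (ε.symm ⟨j, hj⟩)
    rw [← hbj, b.repr_self, Finsupp.single_apply]
    simp [Fin.ext_iff, eq_comm]
  · intro i j hi
    rw [hmul]
    have hmem : B.col j ∈ Submodule.span K (Set.range (B.col ∘ a)) :=
      hspan ▸ Submodule.subset_span ⟨j, rfl⟩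
    have hle : Submodule.span K (Set.range (B.col ∘ a)) ≤ LinearMap.ker (b.coord i) := by
      rw [Submodule.span_le]
      rintro _ ⟨k, rfl⟩
      have hne : Fin.castLE hrm (ε k) ≠ i := by
        rintro rfl
        exact absurd (ε k).isLt (not_lt.mpr hi)
      have hbk : b _ = B.col (a k) := hb k
      simp [← hbk, hne]
    exact hle hmem


/-- Let `R` be a PID with field of fractions `F` and let
`A ∈ M_{m,n}(R)` have rank `r` (as a matrix over `F`) with `0 < r < n`. Then `A`
is associated to a reduced matrix: there are `L ∈ GL_m(F)`, a permutation
`σ` of the `n` columns, a nonzero `d ∈ R` and `K ∈ M_{r,n-r}(R)` such that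
`L · A · Σ` has block form `[[d·I_r, K], [0, 0]]`. -/
theorem reduced_matrix_associated
    (R : Type*) [CommRing R] [IsDomain R] [IsPrincipalIdealRing R]
    (m n r : ℕ) (hr : 0 < r) (hrn : r < n)
    (A : Matrix (Fin m) (Fin n) R)
    (hrank : (A.map (algebraMap R (FractionRing R))).rank = r) :
    ∃ (L : (Matrix (Fin m) (Fin m) (FractionRing R))ˣ) (σ : Equiv.Perm (Fin n))
      (d : R) (K : Matrix (Fin r) (Fin (n - r)) R), d ≠ 0 ∧
      ∀ (i : Fin m) (j : Fin n),
        (L.val * A.map (algebraMap R (FractionRing R)) * σ.permMatrix (FractionRing R)) i j =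
          if hi : (i : ℕ) < r then
            (if hj : (j : ℕ) < r then
              (if (i : ℕ) = (j : ℕ) then algebraMap R (FractionRing R) d else 0)
            else algebraMap R (FractionRing R)
              (K ⟨(i : ℕ), hi⟩ ⟨(j : ℕ) - r, by have := j.isLt; omega⟩))
          else 0 := by
  obtain ⟨L, τ, hone, hzero⟩ := Matrix.exists_units_mul_apply_perm_of_rank_eq _ hrank
  set B := A.map (algebraMap R (FractionRing R))
  obtain ⟨d, hd⟩ := IsLocalization.exist_integer_multiples_of_finite (nonZeroDivisors R)
    fun p : Fin m × Fin n => (L.val * B) p.1 p.2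
  choose c hc using hd
  have hd₀ : (d : R) ≠ 0 := nonZeroDivisors.ne_zero d.2
  have hdF : algebraMap R (FractionRing R) d ≠ 0 := by simp
  have hrm : r ≤ m := hrank ▸ by simpa using B.rank_le_card_height
  refine ⟨Units.mk0 _ hdF • L, τ.symm, d,
    fun i j => c (Fin.castLE hrm i, τ ⟨r + j, by omega⟩), hd₀, fun i j => ?_⟩
  have hentry : ((Units.mk0 _ hdF • L).val * B *
      Equiv.Perm.permMatrix (FractionRing R) τ.symm) i j =
      algebraMap R (FractionRing R) d * (L.val * B) i (τ j) := by
    rw [Equiv.Perm.permMatrix, PEquiv.mul_toMatrix_toPEquiv, Units.val_smul, Units.smul_def,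
      Units.val_mk0, Matrix.smul_mul]
    rfl
  rw [hentry]
  split_ifs with hi hj hij
  · rw [hone i j hj, if_pos hij, mul_one]
  · rw [hone i j hj, if_neg hij, mul_zero]
  · have hjr : (⟨r + (j - r), by omega⟩ : Fin n) = j := Fin.ext (by simp; omega)
    rw [hc, Algebra.smul_def]
    simp only [hjr]
    rfl
  · rw [hzero i _ (not_lt.mp hi), mul_zero]
end

section
/- Let R be a principal ideal domain with field of fractions F, let 0 < r < n, f = n − r, let d ∈ R be nonzero, K ∈ M_{r,f}(R), and J = (d·I_r | K), with N the nullspace of J in R^n and W the R-span of V(1), …, V(f). Let R̄ = R/Rd and let K̄ ∈ M_{r,f}(R̄) be the reduction of K modulo Rd. Then the quotient R-module W/N is isomorphic to the column space C(K̄) of K̄, i.e. the R̄-span of the columns of K̄ inside R̄^r. -/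
open scoped Pointwise

/-- The matrix `J = (d·I_r | K) ∈ M_{r,n}(R)`: its first `r` columns form `d·I_r`
and its last `n - r` columns form `K`. -/
noncomputable def Jmat (R : Type*) [CommRing R] (r n : ℕ) (d : R)
    (K : Matrix (Fin r) (Fin (n - r)) R) : Matrix (Fin r) (Fin n) R := fun i j =>
  if hj : (j : ℕ) < r then (if (i : ℕ) = (j : ℕ) then d else 0)
  else K i ⟨(j : ℕ) - r, by have := j.isLt; omega⟩

/-- The vector `V(j) ∈ F^n` whose `i`-th coordinate is `-K_{i,j}/d` for `i < r`,
which is `1` in position `r + j`, and `0` elsewhere. -/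
noncomputable def Vvec (R : Type*) [CommRing R] [IsDomain R] (r n : ℕ) (d : R)
    (K : Matrix (Fin r) (Fin (n - r)) R) (j : Fin (n - r)) :
    Fin n → FractionRing R := fun i =>
  if hi : (i : ℕ) < r then
    -(algebraMap R (FractionRing R) (K ⟨(i : ℕ), hi⟩ j)) / algebraMap R (FractionRing R) d
  else if (i : ℕ) = r + (j : ℕ) then 1 else 0

/-- The coordinatewise inclusion `R^n → F^n`, as an `R`-linear map. -/
noncomputable def toFrac (R : Type*) [CommRing R] (n : ℕ) :
    (Fin n → R) →ₗ[R] (Fin n → FractionRing R) :=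
  LinearMap.pi fun i => (Algebra.linearMap R (FractionRing R)).comp (LinearMap.proj i)

/-- The nullspace `N = {X ∈ R^n : JX = 0}` of `J` in `R^n`, viewed (via the inclusion
`R^n ⊆ F^n`) as an `R`-submodule of `F^n`. -/
noncomputable def Nsub (R : Type*) [CommRing R] [IsDomain R] (r n : ℕ) (d : R)
    (K : Matrix (Fin r) (Fin (n - r)) R) : Submodule R (Fin n → FractionRing R) :=
  (LinearMap.ker (Jmat R r n d K).mulVecLin).map (toFrac R n)

/-- `W`, the `R`-span of `V(1), …, V(f)` in `F^n`. -/
noncomputable def Wsub (R : Type*) [CommRing R] [IsDomain R] (r n : ℕ) (d : R)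
    (K : Matrix (Fin r) (Fin (n - r)) R) : Submodule R (Fin n → FractionRing R) :=
  Submodule.span R (Set.range (Vvec R r n d K))

/-- If `φ` and `ψ` have the same domain and `ker ψ` is the preimage of `N` under `φ`, then
`range φ / N` is isomorphic to `range ψ`. -/
theorem nonempty_range_quotient_equiv_range {R M P Q : Type*} [CommRing R]
    [AddCommGroup M] [Module R M] [AddCommGroup P] [Module R P] [AddCommGroup Q] [Module R Q]
    (φ : M →ₗ[R] P) (ψ : M →ₗ[R] Q) (N : Submodule R P)
    (h : ∀ c, φ c ∈ N ↔ ψ c = 0) :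
    Nonempty ((↥(LinearMap.range φ) ⧸ N.comap (LinearMap.range φ).subtype) ≃ₗ[R]
      ↥(LinearMap.range ψ)) := by
  let π := (N.comap (LinearMap.range φ).subtype).mkQ ∘ₗ φ.rangeRestrict
  have hπ : Function.Surjective π :=
    (Submodule.mkQ_surjective _).comp φ.surjective_rangeRestrict
  have hker : LinearMap.ker π = LinearMap.ker ψ := by
    ext c
    simp [π, h]
  exact ⟨(π.quotKerEquivOfSurjective hπ).symm ≪≫ₗ Submodule.quotEquivOfEq _ _ hker ≪≫ₗ
    ψ.quotKerEquivRange⟩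

theorem Fin.sum_univ_eq_sum_castLE_add_sum {M : Type*} [AddCommMonoid M] {r n : ℕ} (h : r ≤ n)
    (g : Fin n → M) :
    ∑ k, g k = ∑ i : Fin r, g (i.castLE h) +
      ∑ j : Fin (n - r), g ⟨r + j, by omega⟩ := by
  rw [← (finCongr (Nat.add_sub_cancel' h)).sum_comp, Fin.sum_univ_add]
  rfl

theorem Jmat_mulVec_apply {R : Type*} [CommRing R] {r n : ℕ} (h : r ≤ n) (d : R)
    (K : Matrix (Fin r) (Fin (n - r)) R) (X : Fin n → R) (i : Fin r) :
    (Jmat R r n d K).mulVec X i =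
      d * X (i.castLE h) + ∑ j : Fin (n - r), K i j * X ⟨r + j, by omega⟩ := by
  simp [Matrix.mulVec, dotProduct, Fin.sum_univ_eq_sum_castLE_add_sum h, Jmat,
    ← Fin.ext_iff]

section

variable {R : Type*} [CommRing R] [IsDomain R] {r n : ℕ} {d : R}
  {K : Matrix (Fin r) (Fin (n - r)) R}

theorem sum_smul_Vvec_castLE (h : r ≤ n) (c : Fin (n - r) → R) (i : Fin r) :
    (∑ j, c j • Vvec R r n d K j) (i.castLE h) =
      -algebraMap R (FractionRing R) (∑ j, K i j * c j) / algebraMap R (FractionRing R) d := by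
  simp only [Finset.sum_apply, Pi.smul_apply, map_sum, map_mul, ← Finset.sum_neg_distrib,
    Finset.sum_div]
  refine Finset.sum_congr rfl fun j _ => ?_
  simp only [Vvec, Fin.val_castLE, Fin.is_lt, dite_true, Fin.eta, Algebra.smul_def]
  ring

theorem sum_smul_Vvec_add (c : Fin (n - r) → R) (j : Fin (n - r)) :
    (∑ k, c k • Vvec R r n d K k) ⟨r + j, by omega⟩ = algebraMap R (FractionRing R) (c j) := by
  simp [Finset.sum_apply, Vvec, Algebra.smul_def, ← Fin.ext_iff]

theorem sum_smul_Vvec_mem_Nsub_iff (h : r ≤ n) (hd : d ≠ 0) (c : Fin (n - r) → R) :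
    ∑ j, c j • Vvec R r n d K j ∈ Nsub R r n d K ↔ ∀ i, d ∣ ∑ j, K i j * c j := by
  have hinj := IsFractionRing.injective R (FractionRing R)
  have hd' : algebraMap R (FractionRing R) d ≠ 0 := by simpa using hd
  constructor
  · rintro ⟨X, hX, hXc⟩ i
    have hXc' (k) : algebraMap R (FractionRing R) (X k) = _ := congrFun hXc k
    have hc (j : Fin (n - r)) : X ⟨r + j, by omega⟩ = c j :=
      hinj ((hXc' _).trans (sum_smul_Vvec_add c j))
    have hXi := congrFun (show (Jmat R r n d K).mulVec X = 0 from hX) i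
    simp only [Jmat_mulVec_apply h, hc, Pi.zero_apply] at hXi
    exact ⟨-X (i.castLE h), by linear_combination hXi⟩
  · intro hdvd
    choose q hq using hdvd
    let X : Fin n → R := fun k =>
      if hk : (k : ℕ) < r then -q ⟨k, hk⟩ else c ⟨k - r, by omega⟩
    refine ⟨X, ?_, ?_⟩
    · change (Jmat R r n d K).mulVec X = 0
      ext i
      simp [Jmat_mulVec_apply h, X, hq]
    · ext k
      change algebraMap R (FractionRing R) (X k) = _
      by_cases hk : (k : ℕ) < r
      · have hV := sum_smul_Vvec_castLE (d := d) (K := K) h c ⟨k, hk⟩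
        rw [hq, map_mul, ← mul_neg, mul_div_cancel_left₀ _ hd'] at hV
        simpa [X, hk] using hV.symm
      · have hV := sum_smul_Vvec_add (d := d) (K := K) c ⟨k - r, by omega⟩
        have hk' : r + ((k : ℕ) - r) = k := by omega
        simp only [hk', Fin.eta] at hV
        simpa only [X, hk, dite_false] using hV.symm

end

/-- With `R̄ = R/Rd` and `K̄` the reduction of `K` modulo `Rd`, the
quotient `R`-module `W/N` is isomorphic to the column space `C(K̄)` of `K̄`, i.e. the
`R̄`-span of the columns of `K̄` inside `R̄^r`. -/
theorem W_quot_N_iso_colspace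
    (R : Type*) [CommRing R] [IsDomain R] [IsPrincipalIdealRing R]
    (r n : ℕ) (hr : 0 < r) (hrn : r < n) (d : R) (hd : d ≠ 0)
    (K : Matrix (Fin r) (Fin (n - r)) R) :
    Nonempty
      ((↥(Wsub R r n d K) ⧸ (Nsub R r n d K).comap (Wsub R r n d K).subtype) ≃ₗ[R]
        ↥(Submodule.restrictScalars R
          (Submodule.span (R ⧸ Ideal.span {d})
            (Set.range fun j : Fin (n - r) =>
              fun i : Fin r => Ideal.Quotient.mk (Ideal.span {d}) (K i j))))) := by
  let ψ := Fintype.linearCombination R fun j : Fin (n - r) =>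
    fun i : Fin r => Ideal.Quotient.mk (Ideal.span {d}) (K i j)
  have hφ : Wsub R r n d K = LinearMap.range (Fintype.linearCombination R (Vvec R r n d K)) :=
    (Fintype.range_linearCombination R _).symm
  have hψ : Submodule.restrictScalars R (Submodule.span (R ⧸ Ideal.span {d})
      (Set.range fun j : Fin (n - r) =>
        fun i : Fin r => Ideal.Quotient.mk (Ideal.span {d}) (K i j))) = LinearMap.range ψ := by
    rw [Fintype.range_linearCombination]
    exact Submodule.restrictScalars_span R _ Ideal.Quotient.mk_surjective _
  rw [hφ, hψ]
  refine nonempty_range_quotient_equiv_range _ _ _ fun c => ?_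
  rw [Fintype.linearCombination_apply, sum_smul_Vvec_mem_Nsub_iff hrn.le hd, funext_iff]
  refine forall_congr' fun i => ?_
  rw [← Ideal.mem_span_singleton, ← Ideal.Quotient.eq_zero_iff_mem]
  simp [ψ, Fintype.linearCombination_apply, Algebra.smul_def, mul_comm]
end

section
/- Let R be a principal ideal domain with field of fractions F, let 0 < r < n, f = n − r, let d ∈ R be nonzero, K ∈ M_{r,f}(R), and J = (d·I_r | K), with N the nullspace of J in R^n and W the R-span of V(1), …, V(f). Let q_1 | q_2 | ⋯ | q_s be the diagonal entries of the Smith normal form of K, where s = min{r, f}, and let t be the rank of K. Then W/N ≅ (R/Rd_t) ⊕ ⋯ ⊕ (R/Rd_1), where d_i = d/gcd(d, q_i) for 1 ≤ i ≤ t (in particular W/N = 0 when K = 0). -/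
open scoped Pointwise

/-- An element that every common divisor of `a` and `b` divides is a linear combination of
`a` and `b` over a principal ideal ring. -/
theorem exists_eq_mul_add_mul_of_forall_dvd {R : Type*} [CommRing R] [IsPrincipalIdealRing R]
    {a b g : R} (hg : ∀ c : R, c ∣ a → c ∣ b → c ∣ g) : ∃ x y : R, g = x * a + y * b := by
  obtain ⟨h, hh⟩ := IsPrincipalIdealRing.principal (Ideal.span {a, b})
  rw [Ideal.submodule_span_eq] at hh
  have ha : h ∣ a := Ideal.mem_span_singleton.1 (hh ▸ Ideal.subset_span (by simp))
  have hb : h ∣ b := Ideal.mem_span_singleton.1 (hh ▸ Ideal.subset_span (by simp))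
  have hmem : g ∈ Ideal.span {a, b} := hh ▸ Ideal.mem_span_singleton.2 (hg h ha hb)
  obtain ⟨x, y, hxy⟩ := Ideal.mem_span_pair.1 hmem
  exact ⟨x, y, hxy.symm⟩

/-- If `g` is a gcd of `d = g * e` and `q`, then `d ∣ q * y` iff `e ∣ y`. -/
theorem dvd_mul_iff_cofactor_dvd {R : Type*} [CommRing R] [IsDomain R] [IsPrincipalIdealRing R]
    {d q g e : R} (hd : d ≠ 0) (hgq : g ∣ q) (hg : ∀ c : R, c ∣ d → c ∣ q → c ∣ g)
    (hge : g * e = d) (y : R) : d ∣ q * y ↔ e ∣ y := by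
  have hg0 : g ≠ 0 := by rintro rfl; exact hd (by simp [← hge])
  constructor
  · rintro ⟨z, hz⟩
    obtain ⟨a, b, hab⟩ := exists_eq_mul_add_mul_of_forall_dvd hg
    refine ⟨a * y + b * z, mul_left_cancel₀ hg0 ?_⟩
    linear_combination y * hab + b * hz - (a * y + b * z) * hge
  · rintro ⟨z, rfl⟩
    obtain ⟨p, rfl⟩ := hgq
    exact ⟨p * z, by rw [← hge]; ring⟩

/-- Multiplication by a matrix preserves divisibility of all coordinates. -/
theorem dvd_mulVec {R m k : Type*} [CommRing R] [Fintype k] (A : Matrix m k R) {d : R} {v : k → R}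
    (hv : ∀ i, d ∣ v i) (i : m) : d ∣ A.mulVec v i :=
  Finset.dvd_sum fun j _ => (hv j).mul_left _

/-- Multiplication by an invertible matrix does not change divisibility of all coordinates. -/
theorem dvd_units_mulVec_iff {R m : Type*} [CommRing R] [Fintype m] [DecidableEq m]
    (P : (Matrix m m R)ˣ) (d : R) (v : m → R) :
    (∀ i, d ∣ P.val.mulVec v i) ↔ ∀ i, d ∣ v i := by
  refine ⟨fun h => ?_, dvd_mulVec _⟩
  have := dvd_mulVec P⁻¹.val h
  rwa [Matrix.mulVec_mulVec, Units.inv_mul, Matrix.one_mulVec] at this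

/-- A sum over `Fin n` splits into its first `r` and its last `n - r` terms. -/
theorem Fin.sum_univ_split {M : Type*} [AddCommMonoid M] {r n : ℕ} (hrn : r ≤ n) (F : Fin n → M) :
    ∑ i, F i = ∑ i : Fin r, F (Fin.castLE hrn i) +
      ∑ j : Fin (n - r), F ⟨r + j, by have := j.isLt; omega⟩ := by
  rw [← (finCongr (Nat.add_sub_of_le hrn)).sum_comp, Fin.sum_univ_add]
  rfl

theorem Jmat_mulVec {R : Type*} [CommRing R] {r n : ℕ} (hrn : r ≤ n) (d : R)
    (K : Matrix (Fin r) (Fin (n - r)) R) (x : Fin n → R) (i : Fin r) :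
    (Jmat R r n d K).mulVec x i = d * x (Fin.castLE hrn i) +
      K.mulVec (fun j => x ⟨r + j, by have := j.isLt; omega⟩) i := by
  rw [Matrix.mulVec, dotProduct, Fin.sum_univ_split hrn]
  congr 1
  · rw [Finset.sum_eq_single i]
    · simp [Jmat]
    · intro j _ hj
      have : (i : ℕ) ≠ j := fun h => hj (Fin.ext h.symm)
      simp [Jmat, this]
    · simp
  · simp [Jmat, Matrix.mulVec, dotProduct]

section

variable {R : Type*} [CommRing R] [IsDomain R] {r n : ℕ} (d : R)
  (K : Matrix (Fin r) (Fin (n - r)) R) (c : Fin (n - r) → R)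

theorem linearCombination_Vvec_of_lt (i : Fin n) (hi : (i : ℕ) < r) :
    Fintype.linearCombination R (Vvec R r n d K) c i =
      -(algebraMap R (FractionRing R) (K.mulVec c ⟨i, hi⟩)) / algebraMap R (FractionRing R) d := by
  simp only [Fintype.linearCombination_apply, Finset.sum_apply, Pi.smul_apply, Vvec, hi, dif_pos,
    Matrix.mulVec, dotProduct, map_sum, map_mul, ← Finset.sum_neg_distrib, Finset.sum_div]
  exact Finset.sum_congr rfl fun j _ => by rw [Algebra.smul_def]; ring

theorem linearCombination_Vvec_of_ge (i : Fin n) (hi : r ≤ (i : ℕ)) :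
    Fintype.linearCombination R (Vvec R r n d K) c i =
      algebraMap R (FractionRing R) (c ⟨i - r, by have := i.isLt; omega⟩) := by
  simp only [Fintype.linearCombination_apply, Finset.sum_apply, Pi.smul_apply, Vvec, hi.not_gt,
    dif_neg, not_false_eq_true]
  rw [Finset.sum_eq_single ⟨i - r, by have := i.isLt; omega⟩]
  · simp [Nat.add_sub_of_le hi, Algebra.smul_def]
  · intro j _ hj
    have : (i : ℕ) ≠ r + j := fun h => hj (Fin.ext (by simp; omega))
    simp [this]
  · simp

theorem linearCombination_Vvec_mem_Nsub_iff (hrn : r ≤ n) (hd : d ≠ 0) :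
    Fintype.linearCombination R (Vvec R r n d K) c ∈ Nsub R r n d K ↔
      ∀ i, d ∣ K.mulVec c i := by
  have hd' : algebraMap R (FractionRing R) d ≠ 0 := by simpa using hd
  constructor
  · rintro ⟨x, -, hx⟩ i
    have h := congrFun hx (Fin.castLE hrn i)
    rw [linearCombination_Vvec_of_lt d K c _ i.isLt, eq_div_iff hd'] at h
    refine ⟨-x (Fin.castLE hrn i), IsFractionRing.injective R (FractionRing R) ?_⟩
    simp only [toFrac, LinearMap.pi_apply, LinearMap.comp_apply, LinearMap.proj_apply,
      Algebra.linearMap_apply, Fin.val_castLE, Fin.eta] at h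
    rw [map_mul, map_neg]
    linear_combination h
  · intro h
    choose k hk using h
    refine ⟨fun i => if hi : (i : ℕ) < r then -k ⟨i, hi⟩ else
      c ⟨i - r, by have := i.isLt; omega⟩, ?_, ?_⟩
    · refine funext fun i => ?_
      rw [Matrix.mulVecLin_apply, Jmat_mulVec hrn]
      simp [hk]
    · funext i
      rcases lt_or_ge (i : ℕ) r with hi | hi
      · rw [linearCombination_Vvec_of_lt d K c i hi, hk, eq_div_iff hd']
        simp [toFrac, hi]
        ring
      · rw [linearCombination_Vvec_of_ge d K c i hi]
        simp [toFrac, hi.not_gt]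

end

/-- Modules that are images of the same module under maps with equal kernels are isomorphic. -/
theorem nonempty_linearEquiv_of_ker_eq {R M A B : Type*} [CommRing R] [AddCommGroup M]
    [AddCommGroup A] [AddCommGroup B] [Module R M] [Module R A] [Module R B]
    {α : M →ₗ[R] A} {β : M →ₗ[R] B} (hα : Function.Surjective α) (hβ : Function.Surjective β)
    (h : LinearMap.ker α = LinearMap.ker β) : Nonempty (A ≃ₗ[R] B) :=
  ⟨(α.quotKerEquivOfSurjective hα).symm ≪≫ₗ Submodule.quotEquivOfEq _ _ h ≪≫ₗ
    β.quotKerEquivOfSurjective hβ⟩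

/-- For `D` rectangular diagonal with diagonal `q`, every coordinate of `D y` is divisible by `d`
iff every `q i * y i` is. -/
theorem dvd_diagonal_mulVec_iff {R : Type*} [CommRing R] {r f : ℕ} (q : Fin (min r f) → R)
    (d : R) (y : Fin f → R) :
    (∀ i, d ∣ Matrix.mulVec (fun (i : Fin r) (j : Fin f) =>
      if h : (i : ℕ) = (j : ℕ) then q ⟨(i : ℕ), by have := i.isLt; have := j.isLt; omega⟩
      else 0) y i) ↔ ∀ i, d ∣ q i * y (Fin.castLE (min_le_right r f) i) := by
  have key (i : Fin (min r f)) : Matrix.mulVec (fun (i : Fin r) (j : Fin f) =>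
      if h : (i : ℕ) = (j : ℕ) then q ⟨(i : ℕ), by have := i.isLt; have := j.isLt; omega⟩
      else 0) y (Fin.castLE (min_le_left r f) i) = q i * y (Fin.castLE (min_le_right r f) i) := by
    simp only [Matrix.mulVec, dotProduct]
    rw [Finset.sum_eq_single (Fin.castLE (min_le_right r f) i)]
    · simp
    · intro j _ hj
      have : (i : ℕ) ≠ j := fun h => hj (Fin.ext h.symm)
      simp [this]
    · simp
  refine ⟨fun h i => key i ▸ h _, fun h i => ?_⟩
  by_cases hi : (i : ℕ) < f
  · have := h ⟨i, by have := i.isLt; omega⟩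
    rwa [← key] at this
  · simp only [Matrix.mulVec, dotProduct]
    rw [Finset.sum_eq_zero]
    · exact dvd_zero d
    · intro j _
      have : (i : ℕ) ≠ j := by have := j.isLt; omega
      simp [this]

/-- Let `q_1 | ⋯ | q_s` be the diagonal of the Smith normal form
of `K` (`s = min{r, f}`), and let `t` be the rank of `K` (the largest index with
`q_t ≠ 0`). Then `W/N ≅ (R/Rd_t) ⊕ ⋯ ⊕ (R/Rd_1)` where `d_i = d / gcd(d, q_i)`. -/
theorem W_quot_N_structure
    (R : Type*) [CommRing R] [IsDomain R] [IsPrincipalIdealRing R]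
    (r n : ℕ) (hr : 0 < r) (hrn : r < n) (d : R) (hd : d ≠ 0)
    (K : Matrix (Fin r) (Fin (n - r)) R)
    (P : (Matrix (Fin r) (Fin r) R)ˣ) (Q : (Matrix (Fin (n - r)) (Fin (n - r)) R)ˣ)
    (q : Fin (min r (n - r)) → R)
    (hqchain : ∀ i j, i ≤ j → q i ∣ q j)
    (hsnf : P.val * K * Q.val = fun (i : Fin r) (j : Fin (n - r)) =>
      if h : (i : ℕ) = (j : ℕ) then q ⟨(i : ℕ), by have := i.isLt; have := j.isLt; omega⟩
      else 0)
    (t : ℕ) (htle : t ≤ min r (n - r))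
    (ht : ∀ i : Fin (min r (n - r)), q i ≠ 0 ↔ (i : ℕ) < t) :
    ∀ g e : Fin t → R,
      (∀ i : Fin t, g i ∣ d ∧ g i ∣ q (Fin.castLE htle i) ∧
        ∀ c : R, c ∣ d → c ∣ q (Fin.castLE htle i) → c ∣ g i) →
      (∀ i : Fin t, g i * e i = d) →
      Nonempty
        ((↥(Wsub R r n d K) ⧸ (Nsub R r n d K).comap (Wsub R r n d K).subtype) ≃ₗ[R]
          ((i : Fin t) → R ⧸ Ideal.span {e i})) := by
  intro g e hg hge
  let φ : (Fin (n - r) → R) →ₗ[R] Wsub R r n d K :=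
    (Fintype.linearCombination R (Vvec R r n d K)).codRestrict (Wsub R r n d K) fun c => by
      rw [Wsub, ← Fintype.range_linearCombination]
      exact LinearMap.mem_range_self _ c
  have hφ : Function.Surjective φ := by
    rintro ⟨w, hw⟩
    rw [Wsub, ← Fintype.range_linearCombination] at hw
    obtain ⟨c, rfl⟩ := hw
    exact ⟨c, rfl⟩
  have hQ : Function.Surjective Q.val.mulVecLin := fun y =>
    ⟨Q⁻¹.val.mulVec y, by
      rw [Matrix.mulVecLin_apply, Matrix.mulVec_mulVec, Units.mul_inv, Matrix.one_mulVec]⟩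
  let β : (Fin (n - r) → R) →ₗ[R] ((i : Fin t) → R ⧸ Ideal.span {e i}) :=
    LinearMap.pi fun i => (Ideal.span {e i}).mkQ ∘ₗ
      LinearMap.proj (Fin.castLE (htle.trans (min_le_right _ _)) i)
  have hβ : Function.Surjective β := by
    intro z
    choose y hy using fun i => Submodule.Quotient.mk_surjective (Ideal.span {e i}) (z i)
    refine ⟨fun j => if hj : (j : ℕ) < t then y ⟨j, hj⟩ else 0, funext fun i => ?_⟩
    rw [← hy i]
    simp [β]
  refine nonempty_linearEquiv_of_ker_eq
    (α := Submodule.mkQ _ ∘ₗ φ ∘ₗ Q.val.mulVecLin) (β := β)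
    ((Submodule.mkQ_surjective _).comp (hφ.comp hQ)) hβ ?_
  ext y
  rw [LinearMap.mem_ker, LinearMap.comp_apply, Submodule.mkQ_apply, Submodule.Quotient.mk_eq_zero,
    Submodule.mem_comap]
  change Fintype.linearCombination R (Vvec R r n d K) (Q.val.mulVec y) ∈ _ ↔ _
  rw [linearCombination_Vvec_mem_Nsub_iff _ _ _ hrn.le hd, ← dvd_units_mulVec_iff P,
    Matrix.mulVec_mulVec, Matrix.mulVec_mulVec, hsnf, dvd_diagonal_mulVec_iff,
    LinearMap.mem_ker, funext_iff]
  have hβ_apply (i : Fin t) : β y i = 0 ↔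
      e i ∣ y (Fin.castLE (htle.trans (min_le_right _ _)) i) := by
    rw [← Ideal.mem_span_singleton]
    exact Submodule.Quotient.mk_eq_zero _
  have hdvd (i : Fin t) := dvd_mul_iff_cofactor_dvd hd (hg i).2.1 (hg i).2.2 (hge i)
    (y (Fin.castLE (htle.trans (min_le_right _ _)) i))
  refine ⟨fun h i => (hβ_apply i).2 ((hdvd i).1 (h _)), fun h i => ?_⟩
  by_cases hi : (i : ℕ) < t
  · exact (hdvd ⟨i, hi⟩).2 ((hβ_apply ⟨i, hi⟩).1 (h ⟨i, hi⟩))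
  · have : q i = 0 := not_not.1 (mt (ht i).1 hi)
    simp [this]
end

section
/- (Main theorem) Let R be a principal ideal domain with field of fractions F, let A ∈ M_{m,n}(R) have rank r with 0 < r < n, let S be the nullspace of A in R^n, and let Z = L·A·Σ be a reduced matrix associated to A, with blocks d·I_r and K ∈ M_{r,f}(R), f = n − r. Let W be the R-span of the vectors V(1), …, V(f), set U = Σ·W and M = d·U, let q_1 | ⋯ | q_s be the Smith normal form diagonal entries of K, and let t be the rank of K. Then M ⊆ S ⊆ U, U/S ≅ (R/Rd_t) ⊕ ⋯ ⊕ (R/Rd_1) with d_i = d/gcd(d, q_i), and S/M ≅ R/R·gcd(d, q_1) ⊕ ⋯ ⊕ R/R·gcd(d, q_t) ⊕ (R/Rd)^{f−t}. -/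
open scoped Pointwise

/-- A submodule which is the range of an injective map `f`, modulo a submodule whose preimage
under `f` is the kernel of a surjection `g`, is isomorphic to the target of `g`. -/
theorem nonempty_quotient_equiv_of_range {R N V B : Type*} [CommRing R]
    [AddCommGroup N] [Module R N] [AddCommGroup V] [Module R V] [AddCommGroup B] [Module R B]
    (f : N →ₗ[R] V) (hf : Function.Injective f) (g : N →ₗ[R] B) (hg : Function.Surjective g)
    (U S : Submodule R V) (hU : LinearMap.range f = U) (hS : ∀ x, f x ∈ S ↔ g x = 0) :
    Nonempty ((↥U ⧸ S.comap U.subtype) ≃ₗ[R] B) := by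
  subst hU
  let E := LinearEquiv.ofInjective f hf
  have hker : S.comap (LinearMap.range f).subtype
      = LinearMap.ker (g ∘ₗ (E.symm : LinearMap.range f →ₗ[R] N)) := by
    ext u
    obtain ⟨x, rfl⟩ := E.surjective u
    simpa [E] using hS x
  exact ⟨(Submodule.quotEquivOfEq _ _ hker).trans
    (LinearMap.quotKerEquivOfSurjective _ (hg.comp E.symm.surjective))⟩

theorem Fin.sum_univ_eq_add_of_eq_add {M : Type*} [AddCommMonoid M] {n r f : ℕ} (h : n = r + f)
    (a : Fin n → M) :
    ∑ i, a i = ∑ i : Fin r, a ⟨i, by omega⟩ + ∑ j : Fin f, a ⟨r + j, by omega⟩ := by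
  subst h
  exact Fin.sum_univ_add a

/-- If `g = gcd(d, q)` and `d = g * e` is nonzero, then `d ∣ q * y` exactly when `e ∣ y`. -/
theorem dvd_mul_iff_of_gcd {R : Type*} [CommRing R] [IsDomain R] [IsPrincipalIdealRing R]
    {d q g e : R} (hd : d ≠ 0) (hgq : g ∣ q)
    (hg : ∀ c, c ∣ d → c ∣ q → c ∣ g) (hge : g * e = d) (y : R) :
    d ∣ q * y ↔ e ∣ y := by
  obtain ⟨q', rfl⟩ := hgq
  subst hge
  have hg0 : g ≠ 0 := left_ne_zero_of_mul hd
  have hcop : IsCoprime e q' := by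
    rw [← isRelPrime_iff_isCoprime]
    intro c hce hcq
    have h := hg (g * c) (mul_dvd_mul_left g hce) (mul_dvd_mul_left g hcq)
    exact isUnit_of_dvd_one ((mul_dvd_mul_iff_left hg0).1 (by simpa using h))
  rw [mul_assoc, mul_dvd_mul_iff_left hg0]
  exact ⟨hcop.dvd_of_dvd_mul_left, fun h => h.mul_left q'⟩

theorem Matrix.forall_dvd_mulVec {R m n : Type*} [CommRing R] [Fintype n]
    (B : Matrix m n R) {d : R} {x : n → R} (h : ∀ i, d ∣ x i) (i : m) :
    d ∣ (B.mulVec x) i :=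
  Finset.dvd_sum fun j _ => (h j).mul_left _

theorem Matrix.forall_dvd_units_mulVec_iff {R n : Type*} [CommRing R] [Fintype n] [DecidableEq n]
    (P : (Matrix n n R)ˣ) {d : R} {x : n → R} :
    (∀ i, d ∣ (P.val.mulVec x) i) ↔ ∀ i, d ∣ x i := by
  refine ⟨fun h => ?_, fun h => Matrix.forall_dvd_mulVec _ h⟩
  have := Matrix.forall_dvd_mulVec P.inv h
  simpa [Matrix.mulVec_mulVec] using this

/-- The combination `∑ j, x j • V(j)`. -/
noncomputable def vvecComb (R : Type*) [CommRing R] [IsDomain R] (r n : ℕ) (d : R)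
    (K : Matrix (Fin r) (Fin (n - r)) R) : (Fin (n - r) → R) →ₗ[R] (Fin n → FractionRing R) :=
  Fintype.linearCombination R (Vvec R r n d K)

section vvecComb

variable {R : Type*} [CommRing R] [IsDomain R] {r n : ℕ} (d : R)
  (K : Matrix (Fin r) (Fin (n - r)) R) (x : Fin (n - r) → R)

theorem vvecComb_apply_lt (hrn : r < n) (i : Fin r) :
    vvecComb R r n d K x ⟨i, i.2.trans hrn⟩
      = -algebraMap R (FractionRing R) (K.mulVec x i) / algebraMap R (FractionRing R) d := by
  simp only [vvecComb, Fintype.linearCombination_apply, Finset.sum_apply, Pi.smul_apply, Vvec,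
    i.2, dite_true, Matrix.mulVec, dotProduct, map_sum, map_mul, ← Finset.sum_neg_distrib,
    Finset.sum_div]
  exact Finset.sum_congr rfl fun j _ => by rw [Algebra.smul_def]; ring

theorem vvecComb_apply_add (j : Fin (n - r)) :
    vvecComb R r n d K x ⟨r + j, by omega⟩ = algebraMap R (FractionRing R) (x j) := by
  simp only [vvecComb, Fintype.linearCombination_apply, Finset.sum_apply, Pi.smul_apply, Vvec]
  simp [Algebra.smul_def, Fin.val_inj]

theorem range_vvecComb : LinearMap.range (vvecComb R r n d K) = Wsub R r n d K :=
  Fintype.range_linearCombination R _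

end vvecComb

/-- The solutions of the linear system with reduced matrix `(d·I_r | K)`. -/
theorem mulVec_comp_perm_eq_zero_iff {R : Type*} [CommRing R] [IsDomain R]
    {m n r : ℕ} (hrn : r < n) (hrm : r ≤ m)
    (A : Matrix (Fin m) (Fin n) (FractionRing R))
    (L : (Matrix (Fin m) (Fin m) (FractionRing R))ˣ) (σ : Equiv.Perm (Fin n))
    (d : R) (K : Matrix (Fin r) (Fin (n - r)) R)
    (hZ : ∀ (i : Fin m) (j : Fin n),
      (L.val * A * σ.permMatrix (FractionRing R)) i j =
        if hi : (i : ℕ) < r then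
          (if hj : (j : ℕ) < r then
            (if (i : ℕ) = (j : ℕ) then algebraMap R (FractionRing R) d else 0)
          else algebraMap R (FractionRing R)
            (K ⟨(i : ℕ), hi⟩ ⟨(j : ℕ) - r, by have := j.isLt; omega⟩))
        else 0)
    (v : Fin n → FractionRing R) :
    A.mulVec (v ∘ σ) = 0 ↔ ∀ i : Fin r,
      algebraMap R (FractionRing R) d * v ⟨i, i.2.trans hrn⟩
        + ∑ j : Fin (n - r), algebraMap R (FractionRing R) (K i j) * v ⟨r + j, by omega⟩ = 0 := by
  have hL : A.mulVec (v ∘ σ) = 0 ↔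
      (L.val * A * σ.permMatrix (FractionRing R)).mulVec v = 0 := by
    rw [← Matrix.mulVec_mulVec, ← Matrix.mulVec_mulVec, Matrix.permMatrix_mulVec]
    refine ⟨fun h => by rw [h, Matrix.mulVec_zero], fun h => ?_⟩
    have := congrArg L.inv.mulVec h
    simpa [Matrix.mulVec_mulVec] using this
  have hrow : ∀ i : Fin r,
      (L.val * A * σ.permMatrix (FractionRing R)).mulVec v ⟨i, i.2.trans_le hrm⟩
        = algebraMap R (FractionRing R) d * v ⟨i, i.2.trans hrn⟩
        + ∑ j : Fin (n - r), algebraMap R (FractionRing R) (K i j) * v ⟨r + j, by omega⟩ := by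
    intro i
    simp only [Matrix.mulVec, dotProduct, hZ]
    rw [Fin.sum_univ_eq_add_of_eq_add (show n = r + (n - r) by omega)]
    simp [Fin.val_inj]
  rw [hL]
  refine ⟨fun h i => by rw [← hrow, h, Pi.zero_apply], fun h => ?_⟩
  ext i
  by_cases hi : (i : ℕ) < r
  · exact (hrow ⟨i, hi⟩).trans (h ⟨i, hi⟩)
  · simp [Matrix.mulVec, dotProduct, hZ, hi]

theorem toFrac_mulVec_eq_zero_iff {R : Type*} [CommRing R] [IsDomain R] {m n : ℕ}
    (A : Matrix (Fin m) (Fin n) R) (y : Fin n → R) :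
    (A.map (algebraMap R (FractionRing R))).mulVec (toFrac R n y) = 0 ↔ A.mulVec y = 0 := by
  have h : (A.map (algebraMap R (FractionRing R))).mulVec (toFrac R n y)
      = algebraMap R (FractionRing R) ∘ A.mulVec y :=
    funext fun i => by simp [Matrix.mulVec, dotProduct, toFrac]
  rw [h]
  simp [funext_iff]

/-- **Main theorem.** Let `A ∈ M_{m,n}(R)` have rank `0 < r < n` and
nullspace `S` in `R^n`, let `Z = L·A·Σ` be a reduced matrix associated to `A` with
blocks `d·I_r` and `K`, let `W` be the `R`-span of `V(1), …, V(f)`, `U = Σ·W`,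
`M = d·U`, let `q_1 | ⋯ | q_s` be the Smith normal form diagonal of `K` and `t` the
rank of `K`. Then `M ⊆ S ⊆ U`, `U/S ≅ ⊕ᵢ R/Rd_i` with `d_i = d/gcd(d,q_i)`, and
`S/M ≅ ⊕ᵢ R/R·gcd(d,q_i) ⊕ (R/Rd)^{f-t}`. -/
theorem main_theorem
    (R : Type*) [CommRing R] [IsDomain R] [IsPrincipalIdealRing R]
    (m n r : ℕ) (hr : 0 < r) (hrn : r < n)
    (A : Matrix (Fin m) (Fin n) R)
    (hrank : (A.map (algebraMap R (FractionRing R))).rank = r)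
    (L : (Matrix (Fin m) (Fin m) (FractionRing R))ˣ) (σ : Equiv.Perm (Fin n))
    (d : R) (hd : d ≠ 0) (K : Matrix (Fin r) (Fin (n - r)) R)
    (hZ : ∀ (i : Fin m) (j : Fin n),
      (L.val * A.map (algebraMap R (FractionRing R)) * σ.permMatrix (FractionRing R)) i j =
        if hi : (i : ℕ) < r then
          (if hj : (j : ℕ) < r then
            (if (i : ℕ) = (j : ℕ) then algebraMap R (FractionRing R) d else 0)
          else algebraMap R (FractionRing R)
            (K ⟨(i : ℕ), hi⟩ ⟨(j : ℕ) - r, by have := j.isLt; omega⟩))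
        else 0)
    (P : (Matrix (Fin r) (Fin r) R)ˣ) (Q : (Matrix (Fin (n - r)) (Fin (n - r)) R)ˣ)
    (q : Fin (min r (n - r)) → R)
    (hqchain : ∀ i j, i ≤ j → q i ∣ q j)
    (hsnf : P.val * K * Q.val = fun (i : Fin r) (j : Fin (n - r)) =>
      if h : (i : ℕ) = (j : ℕ) then q ⟨(i : ℕ), by have := i.isLt; have := j.isLt; omega⟩
      else 0)
    (t : ℕ) (htle : t ≤ min r (n - r))
    (ht : ∀ i : Fin (min r (n - r)), q i ≠ 0 ↔ (i : ℕ) < t)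
    (S : Submodule R (Fin n → FractionRing R))
    (hS : S = (LinearMap.ker A.mulVecLin).map (toFrac R n))
    (U : Submodule R (Fin n → FractionRing R))
    (hU : U = (Wsub R r n d K).map
      (((σ.permMatrix (FractionRing R)).mulVecLin).restrictScalars R)) :
    d • U ≤ S ∧ S ≤ U ∧
    ∀ g e : Fin t → R,
      (∀ i : Fin t, g i ∣ d ∧ g i ∣ q (Fin.castLE htle i) ∧
        ∀ c : R, c ∣ d → c ∣ q (Fin.castLE htle i) → c ∣ g i) →
      (∀ i : Fin t, g i * e i = d) →
      Nonempty ((↥U ⧸ S.comap U.subtype) ≃ₗ[R]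
          ((i : Fin t) → R ⧸ Ideal.span {e i})) ∧
      Nonempty ((↥S ⧸ ((d • U).comap S.subtype)) ≃ₗ[R]
          (((i : Fin t) → R ⧸ Ideal.span {g i}) ×
            (Fin (n - r - t) → R ⧸ Ideal.span {d}))) := by
  have hrm : r ≤ m := by
    rw [← hrank]; simpa using Matrix.rank_le_card_height (A.map (algebraMap R (FractionRing R)))
  have hd' : algebraMap R (FractionRing R) d ≠ 0 := by simpa using hd
  have hsol := mulVec_comp_perm_eq_zero_iff hrn hrm _ L σ d K hZ
  let φ : (Fin (n - r) → R) →ₗ[R] (Fin n → FractionRing R) :=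
    (((σ.permMatrix (FractionRing R)).mulVecLin).restrictScalars R) ∘ₗ vvecComb R r n d K
  have hφ : ∀ x, φ x = vvecComb R r n d K x ∘ σ := fun x =>
    Matrix.permMatrix_mulVec _
  have hφinj : Function.Injective φ := by
    intro x y hxy
    rw [hφ, hφ] at hxy
    have h := σ.surjective.injective_comp_right hxy
    ext j
    have := congrFun h ⟨r + j, by omega⟩
    rw [vvecComb_apply_add, vvecComb_apply_add] at this
    exact IsFractionRing.injective R (FractionRing R) this
  have hφU : LinearMap.range φ = U := by
    rw [hU, LinearMap.range_comp, range_vvecComb]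
  have hφS : ∀ x, φ x ∈ S ↔ ∀ i, d ∣ K.mulVec x i := by
    intro x
    rw [hS, hφ]
    constructor
    · rintro ⟨y, -, hy⟩ i
      have h := congrFun hy (σ.symm ⟨i, i.2.trans hrn⟩)
      simp only [Function.comp_apply, Equiv.apply_symm_apply, vvecComb_apply_lt _ _ _ hrn] at h
      rw [eq_div_iff hd'] at h
      refine ⟨-y (σ.symm ⟨i, i.2.trans hrn⟩), IsFractionRing.injective R (FractionRing R) ?_⟩
      simp only [toFrac, LinearMap.pi_apply, LinearMap.comp_apply, LinearMap.proj_apply,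
        Algebra.linearMap_apply] at h
      rw [map_mul, map_neg]
      linear_combination h
    · intro h
      choose c hc using h
      let y : Fin n → R := fun k =>
        if hk : (k : ℕ) < r then -c ⟨k, hk⟩ else x ⟨k - r, by omega⟩
      have hy : toFrac R n (y ∘ σ) = vvecComb R r n d K x ∘ σ := by
        ext k
        simp only [toFrac, LinearMap.pi_apply, LinearMap.comp_apply, LinearMap.proj_apply,
          Algebra.linearMap_apply, Function.comp_apply]
        generalize σ k = k
        by_cases hk : (k : ℕ) < r
        · have := vvecComb_apply_lt d K x hrn ⟨k, hk⟩
          rw [hc] at this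
          simp only [Fin.eta] at this
          simp only [this, y, hk, dite_true, map_neg, map_mul]
          field_simp
        · have := vvecComb_apply_add d K x ⟨k - r, by omega⟩
          simp only [show r + ((k : ℕ) - r) = k by omega, Fin.eta] at this
          simp [this, y, hk]
      refine ⟨y ∘ σ, ?_, hy⟩
      rw [SetLike.mem_coe, LinearMap.mem_ker, Matrix.mulVecLin_apply, ← toFrac_mulVec_eq_zero_iff,
        hy, hsol]
      intro i
      simp only [vvecComb_apply_lt _ _ _ hrn, vvecComb_apply_add, Matrix.mulVec, dotProduct, map_sum,
        map_mul]
      field_simp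
      ring
  have hSU : S ≤ U := by
    rw [← hφU, hS]
    rintro _ ⟨y, hy, rfl⟩
    rw [SetLike.mem_coe, LinearMap.mem_ker, Matrix.mulVecLin_apply,
      ← toFrac_mulVec_eq_zero_iff] at hy
    have hv : toFrac R n y = toFrac R n (y ∘ σ.symm) ∘ σ := by ext; simp [toFrac]
    rw [hv, hsol] at hy
    refine ⟨fun j => y (σ.symm ⟨r + j, by omega⟩), ?_⟩
    rw [hφ, hv]
    congr 1
    ext k
    by_cases hk : (k : ℕ) < r
    · have h := vvecComb_apply_lt d K (fun j => y (σ.symm ⟨r + j, by omega⟩)) hrn ⟨k, hk⟩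
      have h2 := hy ⟨k, hk⟩
      simp only [Fin.eta] at h h2
      rw [h, div_eq_iff hd']
      simp only [Matrix.mulVec, dotProduct, map_sum, map_mul]
      simp only [toFrac, LinearMap.pi_apply, LinearMap.comp_apply, LinearMap.proj_apply,
        Algebra.linearMap_apply, Function.comp_apply] at h2 ⊢
      linear_combination -h2
    · have h := vvecComb_apply_add d K (fun j => y (σ.symm ⟨r + j, by omega⟩)) ⟨k - r, by omega⟩
      simp only [show r + ((k : ℕ) - r) = k by omega, Fin.eta] at h
      simp [h, toFrac]
  have hdU : ∀ x, φ x ∈ d • U ↔ ∀ j, d ∣ x j := by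
    intro x
    rw [Submodule.mem_smul_pointwise_iff_exists, ← hφU]
    constructor
    · rintro ⟨_, ⟨z, rfl⟩, hz⟩ j
      rw [← map_smul] at hz
      exact ⟨z j, (congrFun (hφinj hz) j).symm⟩
    · intro h
      choose z hz using h
      exact ⟨φ z, ⟨z, rfl⟩, by rw [← map_smul]; congr 1; ext j; simp [hz]⟩
  refine ⟨?_, hSU, ?_⟩
  · intro u hu
    obtain ⟨x, rfl⟩ : u ∈ LinearMap.range φ := hφU ▸ Submodule.smul_le_self_of_tower d U hu
    exact (hφS x).2 (Matrix.forall_dvd_mulVec K ((hdU x).1 hu))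
  intro g e hg hge
  have htf : t ≤ n - r := htle.trans (min_le_right _ _)
  let ψ := φ ∘ₗ Q.val.mulVecLin
  have hQbij : Function.Bijective Q.val.mulVecLin := by
    refine ⟨fun a b hab => ?_, fun b => ⟨Q.inv.mulVec b, ?_⟩⟩
    · have := congrArg Q.inv.mulVec hab
      simpa [Matrix.mulVec_mulVec] using this
    · simp [Matrix.mulVec_mulVec]
  have hψinj : Function.Injective ψ := hφinj.comp hQbij.1
  have hψU : LinearMap.range ψ = U := by
    rw [LinearMap.range_comp, LinearMap.range_eq_top.2 hQbij.2, Submodule.map_top, hφU]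
  have hψdU : ∀ y, ψ y ∈ d • U ↔ ∀ j, d ∣ y j := fun y =>
    (hdU _).trans (Matrix.forall_dvd_units_mulVec_iff Q)
  have hψS : ∀ y, ψ y ∈ S ↔ ∀ i : Fin t, e i ∣ y (Fin.castLE htf i) := by
    intro y
    have hKQ : ψ y ∈ S ↔ ∀ i, d ∣ (P.val * K * Q.val).mulVec y i := by
      rw [Matrix.mul_assoc, ← Matrix.mulVec_mulVec, Matrix.forall_dvd_units_mulVec_iff,
        ← Matrix.mulVec_mulVec]
      exact hφS _
    have hrow : ∀ (i : Fin r) (j : Fin (n - r)) (hij : (i : ℕ) = j),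
        (P.val * K * Q.val).mulVec y i = q ⟨i, by omega⟩ * y j := by
      intro i j hij
      rw [hsnf]
      simp only [Matrix.mulVec, dotProduct]
      rw [Finset.sum_eq_single j]
      · simp [hij]
      · intro b _ hb
        rw [dif_neg, zero_mul]
        intro hib
        exact hb (Fin.ext (by omega))
      · simp
    rw [hKQ]
    constructor
    · intro h i
      have hi := h ⟨i, by omega⟩
      rw [hrow _ (Fin.castLE htf i) rfl] at hi
      exact (dvd_mul_iff_of_gcd hd (hg i).2.1 (hg i).2.2 (hge i) _).1 hi
    · intro h i
      by_cases hif : (i : ℕ) < n - r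
      · rw [hrow i ⟨i, hif⟩ rfl]
        by_cases hit : (i : ℕ) < t
        · exact (dvd_mul_iff_of_gcd hd (hg ⟨i, hit⟩).2.1 (hg ⟨i, hit⟩).2.2 (hge ⟨i, hit⟩) _).2
            (h ⟨i, hit⟩)
        · have : q ⟨i, by omega⟩ = 0 := by
            by_contra hq
            exact hit ((ht _).1 hq)
          simp [this]
      · rw [hsnf]
        simp only [Matrix.mulVec, dotProduct]
        rw [Finset.sum_eq_zero]
        · exact dvd_zero d
        · intro b _
          rw [dif_neg (by omega), zero_mul]
  constructor
  · let p : (Fin (n - r) → R) →ₗ[R] ((i : Fin t) → R ⧸ Ideal.span {e i}) :=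
      LinearMap.pi fun i => (Submodule.mkQ (Ideal.span {e i})) ∘ₗ LinearMap.proj (Fin.castLE htf i)
    refine nonempty_quotient_equiv_of_range ψ hψinj p ?_ U S hψU ?_
    · intro b
      choose a ha using fun i => Submodule.mkQ_surjective (Ideal.span {e i}) (b i)
      refine ⟨fun j => if hj : (j : ℕ) < t then a ⟨j, hj⟩ else 0, ?_⟩
      ext i
      simpa [p] using ha i
    · intro y
      rw [hψS, funext_iff]
      refine forall_congr' fun i => ?_
      rw [← Ideal.mem_span_singleton]
      exact (Submodule.Quotient.mk_eq_zero _).symm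
  · let c : Fin (n - r) → R := fun j => if hj : (j : ℕ) < t then e ⟨j, hj⟩ else 1
    have hclt : ∀ i : Fin t, c (Fin.castLE htf i) = e i := fun i => by simp [c]
    have hcge : ∀ j : Fin (n - r), ¬ (j : ℕ) < t → c j = 1 := fun j hj => by simp [c, hj]
    have he0 : ∀ i, e i ≠ 0 := fun i => right_ne_zero_of_mul (hge i ▸ hd)
    have hc0 : ∀ j, c j ≠ 0 := by
      intro j
      by_cases hj : (j : ℕ) < t
      · simpa [c, hj] using he0 _
      · simp [c, hj]
    let E : (Fin (n - r) → R) →ₗ[R] (Fin (n - r) → R) :=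
      LinearMap.pi fun j => c j • LinearMap.proj j
    have hE : ∀ z j, E z j = c j * z j := fun z j => rfl
    have hEinj : Function.Injective E := fun a b hab => funext fun j =>
      mul_left_cancel₀ (hc0 j) (congrFun hab j)
    have hES : LinearMap.range (ψ ∘ₗ E) = S := by
      ext u
      constructor
      · rintro ⟨z, rfl⟩
        refine (hψS _).2 fun i => ?_
        rw [hE, hclt]
        exact dvd_mul_right _ _
      · intro hu
        obtain ⟨y, rfl⟩ : u ∈ LinearMap.range ψ := hψU ▸ hSU hu
        have hy := (hψS y).1 hu
        have hdvd : ∀ j, c j ∣ y j := by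
          intro j
          by_cases hj : (j : ℕ) < t
          · have := hy ⟨j, hj⟩
            rwa [← hclt] at this
          · rw [hcge j hj]; exact one_dvd _
        choose z hz using hdvd
        exact ⟨z, congrArg ψ (funext fun j => (hz j).symm)⟩
    let p : (Fin (n - r) → R) →ₗ[R] (((i : Fin t) → R ⧸ Ideal.span {g i}) ×
        (Fin (n - r - t) → R ⧸ Ideal.span {d})) :=
      LinearMap.prod
        (LinearMap.pi fun i =>
          (Submodule.mkQ (Ideal.span {g i})) ∘ₗ LinearMap.proj (Fin.castLE htf i))
        (LinearMap.pi fun k =>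
          (Submodule.mkQ (Ideal.span {d})) ∘ₗ LinearMap.proj ⟨t + k, by omega⟩)
    refine nonempty_quotient_equiv_of_range (ψ ∘ₗ E) (hψinj.comp hEinj) p ?_ S (d • U) hES ?_
    · rintro ⟨b, b'⟩
      choose a ha using fun i => Submodule.mkQ_surjective (Ideal.span {g i}) (b i)
      choose a' ha' using fun k => Submodule.mkQ_surjective (Ideal.span {d}) (b' k)
      refine ⟨fun j => if hj : (j : ℕ) < t then a ⟨j, hj⟩ else a' ⟨j - t, by omega⟩, ?_⟩
      refine Prod.ext (funext fun i => ?_) (funext fun k => ?_)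
      · simpa [p] using ha i
      · simpa [p] using ha' k
    · intro z
      have hp : p z = 0 ↔ (∀ i : Fin t, g i ∣ z (Fin.castLE htf i)) ∧
          ∀ k : Fin (n - r - t), d ∣ z ⟨t + k, by omega⟩ := by
        rw [Prod.ext_iff, funext_iff, funext_iff]
        simp only [← Ideal.mem_span_singleton]
        exact and_congr (forall_congr' fun i => Submodule.Quotient.mk_eq_zero _)
          (forall_congr' fun k => Submodule.Quotient.mk_eq_zero _)
      have hlt : ∀ i : Fin t, d ∣ E z (Fin.castLE htf i) ↔ g i ∣ z (Fin.castLE htf i) := by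
        intro i
        rw [hE, hclt, ← hge i, mul_comm (g i), mul_dvd_mul_iff_left (he0 i)]
      rw [hp]
      refine (hψdU (E z)).trans ⟨fun h => ⟨fun i => (hlt i).1 (h _), fun k => ?_⟩, ?_⟩
      · have := h ⟨t + k, by omega⟩
        rwa [hE, hcge _ (by simp), one_mul] at this
      · rintro ⟨h1, h2⟩ j
        by_cases hj : (j : ℕ) < t
        · exact (hlt ⟨j, hj⟩).2 (h1 ⟨j, hj⟩)
        · rw [hE, hcge j hj, one_mul]
          have := h2 ⟨j - t, by omega⟩
          simpa only [show t + ((j : ℕ) - t) = j by omega, Fin.eta] using this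
end

section
/- Let R be a principal ideal domain, let P be a free R-module of rank f, and let u_1, …, u_{f+1} ∈ P generate P. Suppose a_1, …, a_{f+1} ∈ R satisfy a_1·u_1 + ⋯ + a_{f+1}·u_{f+1} = 0 and gcd(a_1, …, a_{f+1}) = 1, and suppose Q ∈ GL_{f+1}(R) satisfies (a_1, …, a_{f+1})·Q = (1, 0, …, 0). Define v_j = Σ_{k=1}^{f+1} (Q^{-1})_{j,k}·u_k for 1 ≤ j ≤ f+1. Then v_1 = 0 and {v_2, …, v_{f+1}} is a basis of P. -/
/-- Let `R` be a PID, `P` free of rank `f`, and `u_1, …, u_{f+1}`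
generators of `P`. Suppose `a_1·u_1 + ⋯ + a_{f+1}·u_{f+1} = 0`,
`gcd(a_1, …, a_{f+1}) = 1`, and `Q ∈ GL_{f+1}(R)` satisfies
`(a_1, …, a_{f+1})·Q = (1, 0, …, 0)`. With `v_j = Σ_k (Q⁻¹)_{j,k}·u_k`, then
`v_1 = 0` and `{v_2, …, v_{f+1}}` is a basis of `P`. -/
theorem basis_from_unimodular_relation
    (R : Type*) [CommRing R] [IsDomain R] [IsPrincipalIdealRing R]
    (P : Type*) [AddCommGroup P] [Module R P]
    (f : ℕ) [Module.Free R P] (hrank : Module.finrank R P = f)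
    (u : Fin (f + 1) → P) (hu : Submodule.span R (Set.range u) = ⊤)
    (a : Fin (f + 1) → R)
    (hrel : ∑ i, a i • u i = 0)
    (hgcd : Ideal.span (Set.range a) = ⊤)
    (Q : (Matrix (Fin (f + 1)) (Fin (f + 1)) R)ˣ)
    (hQ : Matrix.vecMul a Q.val = Pi.single (0 : Fin (f + 1)) 1)
    (v : Fin (f + 1) → P)
    (hv : ∀ j, v j = ∑ k, ((Q⁻¹ : (Matrix (Fin (f + 1)) (Fin (f + 1)) R)ˣ).val j k) • u k) :
    v 0 = 0 ∧
    LinearIndependent R (fun j : Fin f => v j.succ) ∧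
    Submodule.span R (Set.range fun j : Fin f => v j.succ) = ⊤ := by
  have row_zero : ∀ k, (Q⁻¹).val 0 k = a k := by
    have h : Matrix.vecMul (Pi.single (0 : Fin (f + 1)) 1) (Q⁻¹).val = a := by
      rw [← hQ, Matrix.vecMul_vecMul, Units.mul_inv, Matrix.vecMul_one]
    intro k
    rw [← congrFun h k, Matrix.single_one_vecMul]
    rfl
  have v_zero : v 0 = 0 := by simp only [hv, row_zero, hrel]
  have u_eq : ∀ i, u i = ∑ j, Q.val i j • v j := by
    intro i
    simp only [hv, Finset.smul_sum, smul_smul]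
    rw [Finset.sum_comm]
    simp only [← Finset.sum_smul, ← Matrix.mul_apply, Units.mul_inv, Matrix.one_apply, ite_smul,
      one_smul, zero_smul, Finset.sum_ite_eq, Finset.mem_univ, if_true]
  have span_eq : Submodule.span R (Set.range fun j : Fin f => v j.succ) = ⊤ := by
    rw [eq_top_iff, ← hu, Submodule.span_le]
    rintro _ ⟨i, rfl⟩
    rw [u_eq i, Fin.sum_univ_succ, v_zero, smul_zero, zero_add]
    exact Submodule.sum_mem _ fun j _ =>
      Submodule.smul_mem _ _ (Submodule.subset_span ⟨j, rfl⟩)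
  exact ⟨v_zero, linearIndependent_of_top_le_span_of_card_eq_finrank span_eq.ge
    (by rw [Fintype.card_fin, hrank]), span_eq⟩
end

section
/- Let R be a principal ideal domain, let L be a free R-module of rank f with sublattice M having basis {u_1, …, u_f}, let p ∈ R be a prime, e ≥ 1, and suppose v = (a_1·u_1 + ⋯ + a_f·u_f)/p^e ∈ L with p^{e−1}·v ∉ M, where a_1, …, a_f ∈ R and p ∤ a_1. Then there exist x, y ∈ R with x·a_1 + y·p^e = 1 such that v' = x·v + y·u_1 satisfies v' = (u_1 + x·a_2·u_2 + ⋯ + x·a_f·u_f)/p^e, Rv' + M = Rv + M, and {v', u_2, …, u_f} is a basis of the module P = Rv + M; moreover P/M ≅ R/Rp^e. -/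
open Submodule

section

variable {R L ι : Type*} [CommRing R] [AddCommGroup L] [Module R L]

/-- Replacing one vector of a linearly independent family by a `q`-th part of a combination in which
that vector has coefficient `1` keeps the family linearly independent. -/
theorem LinearIndependent.update_of_smul_eq [IsDomain R] [Fintype ι] [DecidableEq ι]
    {u : ι → L} (hu : LinearIndependent R u) {i : ι} {q : R} (hq : q ≠ 0) {c : ι → R} {w : L}
    (hw : q • w = u i + ∑ j ∈ Finset.univ.erase i, c j • u j) :
    LinearIndependent R (Function.update u i w) := by
  rw [Fintype.linearIndependent_iff] at hu ⊢
  intro g hg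
  have hsum : g i • w + ∑ j ∈ Finset.univ.erase i, g j • u j = 0 := by
    rw [← hg, ← Finset.add_sum_erase _ _ (Finset.mem_univ i), Function.update_self]
    congr 1
    refine Finset.sum_congr rfl fun j hj => ?_
    rw [Function.update_of_ne (Finset.ne_of_mem_erase hj)]
  have key : ∑ j, (if j = i then g i else g i * c j + q * g j) • u j = 0 := by
    rw [← Finset.add_sum_erase _ _ (Finset.mem_univ i), if_pos rfl]
    calc _ = g i • u i + ∑ j ∈ Finset.univ.erase i, (g i * c j + q * g j) • u j := by
          congr 1
          exact Finset.sum_congr rfl fun j hj => by rw [if_neg (Finset.ne_of_mem_erase hj)]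
      _ = q • (g i • w + ∑ j ∈ Finset.univ.erase i, g j • u j) := by
          rw [smul_add, smul_comm q, hw, smul_add, Finset.smul_sum, Finset.smul_sum, add_assoc,
            ← Finset.sum_add_distrib]
          simp only [add_smul, mul_smul]
      _ = 0 := by rw [hsum, smul_zero]
  have hzero := hu _ key
  have hi : g i = 0 := by simpa using hzero i
  intro j
  by_cases hj : j = i
  · rw [hj, hi]
  · simpa [hj, hi, hq] using hzero j

/-- If a multiple of `w` is a combination of the `u j` in which `u i` has coefficient `1`, then
replacing `u i` by `w` yields a spanning family of the sum of `span {w}` and the span of `u`. -/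
theorem Submodule.span_range_update_of_smul_eq [Fintype ι] [DecidableEq ι]
    {u : ι → L} {i : ι} {q : R} {c : ι → R} {w : L}
    (hw : q • w = u i + ∑ j ∈ Finset.univ.erase i, c j • u j) :
    span R (Set.range (Function.update u i w)) = span R {w} ⊔ span R (Set.range u) := by
  have hw_mem : w ∈ span R (Set.range (Function.update u i w)) :=
    subset_span ⟨i, Function.update_self ..⟩
  have hu_mem : ∀ j, j ≠ i → u j ∈ span R (Set.range (Function.update u i w)) := fun j hj =>
    subset_span ⟨j, Function.update_of_ne hj ..⟩
  apply le_antisymm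
  · rw [span_le]
    rintro _ ⟨j, rfl⟩
    by_cases hj : j = i
    · rw [hj, Function.update_self]
      exact mem_sup_left (mem_span_singleton_self w)
    · rw [Function.update_of_ne hj]
      exact mem_sup_right (subset_span ⟨j, rfl⟩)
  · rw [sup_le_iff, span_singleton_le_iff_mem, span_le]
    refine ⟨hw_mem, ?_⟩
    rintro _ ⟨j, rfl⟩
    by_cases hj : j = i
    · rw [hj, eq_sub_of_add_eq hw.symm]
      exact sub_mem (smul_mem _ _ hw_mem) (sum_mem fun k hk =>
        smul_mem _ _ (hu_mem k (Finset.ne_of_mem_erase hk)))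
    · exact hu_mem j hj

/-- If `x * a + y * q = 1`, `m ∈ M` and `q • v ∈ M`, then `x • v + y • m` and `v` generate the same
submodule modulo `M`. -/
theorem Submodule.span_singleton_smul_add_smul_sup {M : Submodule R L} {m v : L} {a q x y : R}
    (hm : m ∈ M) (hv : q • v ∈ M) (hxy : x * a + y * q = 1) :
    span R {x • v + y • m} ⊔ M = span R {v} ⊔ M := by
  apply le_antisymm <;> rw [sup_le_iff, span_singleton_le_iff_mem] <;>
    refine ⟨?_, le_sup_right⟩
  · exact add_mem (mem_sup_left (smul_mem _ _ (mem_span_singleton_self v)))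
      (mem_sup_right (smul_mem _ _ hm))
  · have hv_eq : v = a • (x • v + y • m) + (y • q • v - (a * y) • m) := by
      linear_combination (norm := module) -hxy • v
    have hmem : a • (x • v + y • m) + (y • q • v - (a * y) • m) ∈ span R {x • v + y • m} ⊔ M :=
      add_mem (mem_sup_left (smul_mem _ _ (mem_span_singleton_self _)))
        (mem_sup_right (sub_mem (smul_mem _ _ hv) (smul_mem _ _ hm)))
    rwa [← hv_eq] at hmem

/-- If `q • v` is a combination of the linearly independent `u j` having a coefficient coprime to
`q`, then the order ideal of `v` modulo the span of `u` is generated by `q`. -/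
theorem LinearIndependent.smul_mem_span_range_iff_dvd [Fintype ι]
    {u : ι → L} (hu : LinearIndependent R u) {q : R} {a : ι → R} {v : L}
    (hv : q • v = ∑ j, a j • u j) {i : ι} (hi : IsCoprime q (a i)) (r : R) :
    r • v ∈ span R (Set.range u) ↔ q ∣ r := by
  constructor
  · intro h
    obtain ⟨b, hb⟩ := mem_span_range_iff_exists_fun R |>.1 h
    have heq : ∑ j, (r * a j) • u j = ∑ j, (q * b j) • u j := by
      simp only [mul_smul, ← Finset.smul_sum]
      rw [hb, ← hv, smul_comm]
    have hcoeff : r * a i = q * b i := by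
      have hzero := Fintype.linearIndependent_iff.1 hu (fun j => r * a j - q * b j)
        (by simp only [sub_smul, Finset.sum_sub_distrib, heq, sub_self]) i
      exact sub_eq_zero.1 hzero
    exact hi.dvd_of_dvd_mul_right ⟨b i, hcoeff⟩
  · rintro ⟨s, rfl⟩
    rw [mul_comm, mul_smul, hv]
    exact smul_mem _ _ (sum_mem fun j _ => smul_mem _ _ (subset_span ⟨j, rfl⟩))

/-- If the order ideal of `v` modulo `M` is generated by `q`, then `(Rv + M) / M ≅ R / (q)`. -/
theorem Submodule.nonempty_span_singleton_sup_quotient_equiv {M : Submodule R L} {v : L} {q : R}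
    (h : ∀ r : R, r • v ∈ M ↔ q ∣ r) :
    Nonempty ((↥(span R {v} ⊔ M) ⧸ M.comap (span R {v} ⊔ M).subtype) ≃ₗ[R]
      R ⧸ Ideal.span {q}) := by
  let v' : ↥(span R {v} ⊔ M) := ⟨v, mem_sup_left (mem_span_singleton_self v)⟩
  let φ := (M.comap (span R {v} ⊔ M).subtype).mkQ ∘ₗ LinearMap.toSpanSingleton R _ v'
  have hker : LinearMap.ker φ = Ideal.span {q} := by
    ext r
    simp [φ, v', Ideal.mem_span_singleton, ← h r]
  have hsurj : Function.Surjective φ := by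
    intro z
    obtain ⟨⟨z, hz⟩, rfl⟩ := mkQ_surjective _ z
    obtain ⟨s, hs, m, hm, rfl⟩ := mem_sup.1 hz
    obtain ⟨r, rfl⟩ := mem_span_singleton.1 hs
    refine ⟨r, (Quotient.eq _).2 ?_⟩
    simpa [v'] using hm
  exact ⟨((quotEquivOfEq _ _ hker.symm).trans (φ.quotKerEquivOfSurjective hsurj)).symm⟩

end

/-- Let `R` be a PID, `L` free of rank `f` with sublattice `M`
having basis `{u_1, …, u_f}`, let `p ∈ R` be prime, `e ≥ 1`, and suppose
`v = (a_1·u_1 + ⋯ + a_f·u_f)/p^e ∈ L` with `p^{e-1}·v ∉ M` and `p ∤ a_1`. Then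
there are `x, y ∈ R` with `x·a_1 + y·p^e = 1` such that `v' = x·v + y·u_1`
satisfies `v' = (u_1 + x·a_2·u_2 + ⋯ + x·a_f·u_f)/p^e`, `Rv' + M = Rv + M`, and
`{v', u_2, …, u_f}` is a basis of `P = Rv + M`; moreover `P/M ≅ R/Rp^e`. -/
theorem advance_one_elementary_divisor
    (R : Type*) [CommRing R] [IsDomain R] [IsPrincipalIdealRing R]
    (L : Type*) [AddCommGroup L] [Module R L]
    (f : ℕ) (hf : 0 < f) [Module.Free R L] (hrankL : Module.finrank R L = f)
    (M : Submodule R L) (u : Fin f → L) (hu : ∀ i, u i ∈ M)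
    (huli : LinearIndependent R u)
    (huspan : Submodule.span R (Set.range u) = M)
    (p : R) (hp : Prime p) (e : ℕ) (he : 1 ≤ e)
    (a : Fin f → R) (v : L)
    (hv : p ^ e • v = ∑ i, a i • u i)
    (hnot : p ^ (e - 1) • v ∉ M)
    (hpa : ¬ p ∣ a ⟨0, hf⟩) :
    ∃ x y : R, x * a ⟨0, hf⟩ + y * p ^ e = 1 ∧
      (p ^ e • (x • v + y • u ⟨0, hf⟩) =
        u ⟨0, hf⟩ + ∑ i ∈ Finset.univ.erase ⟨0, hf⟩, (x * a i) • u i) ∧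
      (Submodule.span R {x • v + y • u ⟨0, hf⟩} ⊔ M = Submodule.span R {v} ⊔ M) ∧
      LinearIndependent R (Function.update u ⟨0, hf⟩ (x • v + y • u ⟨0, hf⟩)) ∧
      Submodule.span R (Set.range (Function.update u ⟨0, hf⟩ (x • v + y • u ⟨0, hf⟩))) =
        Submodule.span R {v} ⊔ M ∧
      Nonempty ((↥(Submodule.span R {v} ⊔ M) ⧸
          M.comap (Submodule.span R {v} ⊔ M).subtype) ≃ₗ[R]
        R ⧸ Ideal.span {p ^ e}) := by
  have hcop : IsCoprime (p ^ e) (a ⟨0, hf⟩) :=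
    ((hp.irreducible.coprime_iff_not_dvd).2 hpa).pow_left
  obtain ⟨y, x, hyx⟩ := hcop
  have hxy : x * a ⟨0, hf⟩ + y * p ^ e = 1 := by rw [add_comm, hyx]
  have hv_mem : p ^ e • v ∈ M := hv ▸ sum_mem fun i _ => smul_mem _ _ (hu i)
  have hw : p ^ e • (x • v + y • u ⟨0, hf⟩) =
      u ⟨0, hf⟩ + ∑ i ∈ Finset.univ.erase ⟨0, hf⟩, (x * a i) • u i := by
    rw [smul_add, smul_comm, hv, ← Finset.add_sum_erase _ _ (Finset.mem_univ ⟨0, hf⟩), smul_add,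
      Finset.smul_sum]
    simp only [mul_smul]
    linear_combination (norm := module) hxy • u ⟨0, hf⟩
  have hsup := span_singleton_smul_add_smul_sup (hu ⟨0, hf⟩) hv_mem hxy
  refine ⟨x, y, hxy, hw, hsup, huli.update_of_smul_eq (pow_ne_zero e hp.ne_zero) hw, ?_, ?_⟩
  · rw [span_range_update_of_smul_eq hw, huspan, hsup]
  · refine nonempty_span_singleton_sup_quotient_equiv fun r => ?_
    rw [← huspan]
    exact huli.smul_mem_span_range_iff_dvd hv ⟨y, x, hyx⟩ r
end
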